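/- For k ≥ 0 let p^{[k]} be the probability that a simple random walk on ℤ² started at (1,0), stopped at its first visit to the half-line H = {(k,0) : k ≤ 0}, stops at the point (−k,0). Then for all real z with |z| < 1, ∑_{k≥0} p^{[k]} z^k = (1 − √((1−z)(1 − z(3−2√2))))/z, and as k → ∞, p^{[k]} ∼ √((√2−1)/(2π)) · k^{−3/2}; moreover the probability that the first hitting point lies at abscissa ≤ −k satisfies ∑_{ℓ≥k} p^{[ℓ]} ∼ √(2(√2−1)/π) · k^{−1/2}. -/

import Mathlib

open Filter

/-- The forbidden half-line `H = {(k,0) : k ≤ 0}`. -/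
def slitH : Set (ℤ × ℤ) := {p : ℤ × ℤ | p.2 = 0 ∧ p.1 ≤ 0}

/-- The four steps of the ordinary square lattice. -/
def sqSteps : Set (ℤ × ℤ) := {(1,0), (-1,0), (0,1), (0,-1)}

/-- `b_k(n)`: the number of `n`-step nearest-neighbour walks from `(1,0)` to `(−k,0)`
whose only visit to `H` is at their final step. -/
noncomputable def hitCount (k : ℕ) (n : ℕ) : ℕ :=
  Nat.card {w : Fin (n+1) → ℤ × ℤ //
    w 0 = (1, 0) ∧ (∀ m : Fin n, w m.succ - w m.castSucc ∈ sqSteps)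
      ∧ (∀ m : Fin (n+1), (m : ℕ) < n → w m ∉ slitH)
      ∧ w (Fin.last n) = (-(k : ℤ), 0)}

/-- `p^{[k]}`: the probability that a simple random walk started at `(1,0)` first hits
`H` at the point `(−k,0)`. -/
noncomputable def hitProb (k : ℕ) : ℝ := ∑' n : ℕ, (hitCount k n : ℝ) / 4 ^ n


/-- walks from (1,0) of length `n` ending at `q`, avoiding `H` before the final time. -/
def WalkTo (n : ℕ) (q : ℤ × ℤ) : Type :=
  {w : Fin (n+1) → ℤ × ℤ //
    w 0 = (1, 0) ∧ (∀ m : Fin n, w m.succ - w m.castSucc ∈ sqSteps)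
      ∧ (∀ m : Fin (n+1), (m : ℕ) < n → w m ∉ slitH)
      ∧ w (Fin.last n) = q}

noncomputable def walkNum (n : ℕ) (q : ℤ × ℤ) : ℕ := Nat.card (WalkTo n q)

lemma hitCount_eq_walkNum (k n : ℕ) : hitCount k n = walkNum n (-(k : ℤ), 0) := rfl

noncomputable instance : DecidablePred (· ∈ slitH) := Classical.decPred _

/-- the four steps as a function. -/
def stp : Fin 4 → ℤ × ℤ := ![(1,0), (-1,0), (0,1), (0,-1)]

lemma stp_mem (e : Fin 4) : stp e ∈ sqSteps := by
  fin_cases e <;> simp [stp, sqSteps]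

lemma mem_sqSteps {v : ℤ × ℤ} (h : v ∈ sqSteps) : ∃ e, stp e = v := by
  simp only [sqSteps, Set.mem_insert_iff, Set.mem_singleton_iff] at h
  rcases h with h | h | h | h
  · exact ⟨0, h.symm⟩
  · exact ⟨1, h.symm⟩
  · exact ⟨2, h.symm⟩
  · exact ⟨3, h.symm⟩

lemma stp_inj : Function.Injective stp := by
  intro a b h
  revert h
  revert a b
  decide

/-- decomposition by the last step -/
def extendWalk (n : ℕ) (q : ℤ × ℤ) :
    (Σ e : Fin 4, {_w : WalkTo n (q - stp e) // q - stp e ∉ slitH}) → WalkTo (n+1) q :=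
  fun x => ⟨Fin.snoc (α := fun _ => ℤ × ℤ) x.2.1.1 q, by
    obtain ⟨e, ⟨w, h0, hs, ha, hl⟩, hq⟩ := x
    refine ⟨?_, ?_, ?_, ?_⟩
    · have : (0 : Fin (n+1+1)) = Fin.castSucc 0 := rfl
      rw [this, Fin.snoc_castSucc]; exact h0
    · intro m
      refine Fin.lastCases ?_ (fun m => ?_) m
      · simp only [Fin.succ_last, Fin.snoc_last, Fin.snoc_castSucc]
        rw [hl]; simpa using stp_mem e
      · rw [← Fin.castSucc_succ, Fin.snoc_castSucc, Fin.snoc_castSucc]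
        exact hs m
    · intro m
      refine Fin.lastCases ?_ (fun m => ?_) m
      · intro h; simp at h
      · intro _
        rw [Fin.snoc_castSucc]
        refine Fin.lastCases ?_ (fun m => ?_) m
        · simpa [hl] using hq
        · exact ha _ (by simp)
    · simp⟩

lemma extendWalk_bij (n : ℕ) (q : ℤ × ℤ) : Function.Bijective (extendWalk n q) := by
  constructor
  · rintro ⟨e, ⟨w, h0, hs, ha, hl⟩, hq⟩ ⟨e', ⟨w', h0', hs', ha', hl'⟩, hq'⟩ h
    have h1 : Fin.snoc (α := fun _ => ℤ × ℤ) w q = Fin.snoc (α := fun _ => ℤ × ℤ) w' q :=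
      congrArg Subtype.val h
    have h2 : w = w' := by
      funext i
      have := congrFun h1 i.castSucc
      simpa only [Fin.snoc_castSucc] using this
    subst h2
    have h3 : e = e' := stp_inj (by rw [hl] at hl'; simpa using hl')
    subst h3
    rfl
  · rintro ⟨w, h0, hs, ha, hl⟩
    obtain ⟨e, he⟩ := mem_sqSteps (hs (Fin.last n))
    have hq : q - stp e = w (Fin.last n).castSucc := by
      rw [he, ← hl]; simp
    refine ⟨⟨e, ⟨⟨fun i => w i.castSucc, h0, ?_, ?_, ?_⟩, ?_⟩⟩, ?_⟩
    · intro m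
      exact hs m.castSucc
    · intro m hm
      exact ha m.castSucc (by simp; omega)
    · rw [hq]
    · rw [hq]; exact ha _ (by simp)
    · apply Subtype.ext
      show Fin.snoc (α := fun _ => ℤ × ℤ) (fun i => w i.castSucc) q = w
      funext i
      refine Fin.lastCases ?_ (fun i => ?_) i
      · rw [Fin.snoc_last, hl]
      · rw [Fin.snoc_castSucc]

instance walk_finite (n : ℕ) : ∀ q, Finite (WalkTo n q) := by
  induction n with
  | zero =>
    intro q
    have : Subsingleton (WalkTo 0 q) := by
      constructor
      rintro ⟨w, h0, _⟩ ⟨w', h0', _⟩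
      apply Subtype.ext
      funext i
      have : i = 0 := Fin.ext (by have := i.isLt; simp)
      simp [this, h0, h0']
    exact Finite.of_subsingleton
  | succ n ih =>
    intro q
    exact Finite.of_surjective _ (extendWalk_bij n q).2

lemma walkNum_zero (q : ℤ × ℤ) : walkNum 0 q = if q = (1,0) then 1 else 0 := by
  unfold walkNum
  split_ifs with h
  · rw [Nat.card_eq_one_iff_unique]
    constructor
    · constructor
      rintro ⟨w, h0, _⟩ ⟨w', h0', _⟩
      apply Subtype.ext
      funext i
      have : i = 0 := Fin.ext (by have := i.isLt; simp)
      simp [this, h0, h0']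
    · exact ⟨⟨fun _ => (1,0), rfl, fun m => m.elim0, fun m hm => absurd hm (by omega), h.symm⟩⟩
  · have : IsEmpty (WalkTo 0 q) := ⟨fun ⟨w, h0, _, _, hl⟩ => h (by rw [← hl, ← h0]; rfl)⟩
    exact Nat.card_of_isEmpty

lemma walkNum_succ (n : ℕ) (q : ℤ × ℤ) :
    walkNum (n+1) q = ∑ e, if q - stp e ∈ slitH then 0 else walkNum n (q - stp e) := by
  unfold walkNum
  rw [← Nat.card_eq_of_bijective _ (extendWalk_bij n q), Nat.card_sigma]
  refine Finset.sum_congr rfl fun e _ => ?_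
  split_ifs with h
  · have : IsEmpty {w : WalkTo n (q - stp e) // q - stp e ∉ slitH} := ⟨fun x => x.2 h⟩
    exact Nat.card_of_isEmpty
  · exact Nat.card_congr (Equiv.subtypeUnivEquiv fun _ => h)

lemma walkNum_support (n : ℕ) : (Function.support (walkNum n)).Finite := by
  induction n with
  | zero =>
    refine (Set.finite_singleton ((1,0) : ℤ × ℤ)).subset fun q hq => ?_
    rw [Function.mem_support, walkNum_zero] at hq
    by_contra h
    exact hq (if_neg h)
  | succ n ih =>
    refine (Set.finite_iUnion fun e : Fin 4 => ih.image (· + stp e)).subset fun q hq => ?_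
    rw [Function.mem_support, walkNum_succ] at hq
    obtain ⟨e, _, he⟩ := Finset.exists_ne_zero_of_sum_ne_zero hq
    rw [Set.mem_iUnion]
    refine ⟨e, q - stp e, ?_, by simp⟩
    intro h0
    apply he
    simp [h0]

lemma summable_walk (n : ℕ) (f : ℤ × ℤ → ℂ) : Summable fun q => (walkNum n q : ℂ) * f q := by
  apply summable_of_hasFiniteSupport
  refine (walkNum_support n).subset fun q hq h => hq ?_
  simp [h]

noncomputable def walkSum (n : ℕ) (f : ℤ × ℤ → ℂ) : ℂ := ∑' q, (walkNum n q : ℂ) * f q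

lemma walkSum_succ (n : ℕ) (f : ℤ × ℤ → ℂ) :
    walkSum (n+1) f = walkSum n fun q => if q ∈ slitH then 0 else ∑ e, f (q + stp e) := by
  unfold walkSum
  have key : ∀ e, (Summable fun q => (if q - stp e ∈ slitH then 0 else
        (walkNum n (q - stp e) : ℂ) * f q)) ∧
      ∑' q, (if q - stp e ∈ slitH then 0 else (walkNum n (q - stp e) : ℂ) * f q) =
      ∑' q, (walkNum n q : ℂ) * (if q ∈ slitH then 0 else f (q + stp e)) := by
    intro e
    have h1 : (fun q => (if q - stp e ∈ slitH then 0 else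
        (walkNum n (q - stp e) : ℂ) * f q)) =
        (fun q => (walkNum n q : ℂ) * (if q ∈ slitH then 0 else f (q + stp e))) ∘
          (Equiv.subRight (stp e)) := by
      funext q
      simp
    rw [h1]
    constructor
    · exact (Equiv.summable_iff (Equiv.subRight (stp e))).2 (summable_walk n _)
    · exact Equiv.tsum_eq (Equiv.subRight (stp e))
        (fun q => (walkNum n q : ℂ) * (if q ∈ slitH then 0 else f (q + stp e)))
  have h2 : ∀ q, (walkNum (n+1) q : ℂ) * f q =
      ∑ e, (if q - stp e ∈ slitH then 0 else (walkNum n (q - stp e) : ℂ) * f q) := by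
    intro q
    rw [walkNum_succ]
    push_cast
    rw [Finset.sum_mul]
    refine Finset.sum_congr rfl fun e _ => ?_
    split_ifs <;> simp
  simp_rw [h2]
  rw [Summable.tsum_finsetSum (fun e _ => (key e).1)]
  simp_rw [fun e => (key e).2]
  rw [← Summable.tsum_finsetSum (fun e _ => summable_walk n _)]
  refine tsum_congr fun q => ?_
  rw [← Finset.mul_sum]
  split_ifs <;> simp

lemma walkSum_zero (f : ℤ × ℤ → ℂ) : walkSum 0 f = f (1,0) := by
  unfold walkSum
  rw [tsum_eq_single (1,0)]
  · simp [walkNum_zero]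
  · intro q hq
    simp [walkNum_zero, hq]

noncomputable def hitSum (n : ℕ) (f : ℤ × ℤ → ℂ) : ℂ :=
  ∑' k : ℕ, (hitCount k n : ℂ) * f (-(k : ℤ), 0)

lemma negPt_inj : Function.Injective (fun k : ℕ => ((-(k : ℤ), 0) : ℤ × ℤ)) := by
  intro a b h
  simpa using h

lemma summable_hit (n : ℕ) (f : ℤ × ℤ → ℂ) :
    Summable fun k : ℕ => (hitCount k n : ℂ) * f (-(k : ℤ), 0) :=
  (summable_walk n f).comp_injective negPt_inj

lemma walkSum_split (n : ℕ) (f : ℤ × ℤ → ℂ) :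
    walkSum n f = walkSum n (fun q => if q ∈ slitH then 0 else f q) + hitSum n f := by
  have h1 : hitSum n f = walkSum n (fun q => if q ∈ slitH then f q else 0) := by
    unfold hitSum walkSum
    have := negPt_inj.tsum_eq (f := fun q => (walkNum n q : ℂ) * (if q ∈ slitH then f q else 0)) (by
      intro q hq
      by_cases hh : q ∈ slitH
      · refine ⟨q.1.natAbs, ?_⟩
        obtain ⟨h1, h2⟩ := hh
        ext
        · show -((q.1.natAbs : ℕ) : ℤ) = q.1
          omega
        · simp [h1]
      · simp [hh] at hq)
    rw [← this]
    refine tsum_congr fun k => ?_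
    rw [if_pos (by simp [slitH])]
    rfl
  rw [h1]
  unfold walkSum
  rw [← Summable.tsum_add (summable_walk _ _) (summable_walk _ _)]
  refine tsum_congr fun q => ?_
  split_ifs <;> simp

lemma walkSum_harm (n : ℕ) (f : ℤ × ℤ → ℂ) (t : ℂ)
    (hf : ∀ q, q ∉ slitH → f q = t * ∑ e, f (q + stp e)) :
    walkSum n f = t * walkSum (n+1) f + hitSum n f := by
  rw [walkSum_split, walkSum_succ]
  congr 1
  unfold walkSum
  rw [← tsum_mul_left]
  refine tsum_congr fun q => ?_
  beta_reduce
  split_ifs with h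
  · simp
  · rw [hf q h]; ring

lemma walkSum_telescope (f : ℤ × ℤ → ℂ) (t : ℂ)
    (hf : ∀ q, q ∉ slitH → f q = t * ∑ e, f (q + stp e)) (N : ℕ) :
    f (1,0) = t ^ N * walkSum N f + ∑ n ∈ Finset.range N, t ^ n * hitSum n f := by
  induction N with
  | zero => simp [walkSum_zero]
  | succ N ih =>
    rw [ih, Finset.sum_range_succ, walkSum_harm N f t hf]
    ring

noncomputable def walkTot (n : ℕ) : ℝ := ∑' q, (walkNum n q : ℝ)

lemma summable_walkNum (n : ℕ) : Summable fun q => (walkNum n q : ℝ) := by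
  apply summable_of_hasFiniteSupport
  refine (walkNum_support n).subset fun q hq h => hq ?_
  simp [h]

noncomputable def hitTot (n : ℕ) : ℝ := ∑' k, (hitCount k n : ℝ)

lemma summable_hitCount (n : ℕ) : Summable fun k => (hitCount k n : ℝ) :=
  (summable_walkNum n).comp_injective negPt_inj

lemma tot_telescope (N : ℕ) :
    1 = (1/4) ^ N * walkTot N + ∑ n ∈ Finset.range N, (1/4) ^ n * hitTot n := by
  have := walkSum_telescope (fun _ => 1) (1/4) (by intro q _; simp) N
  have h1 : walkSum N (fun _ => 1) = (walkTot N : ℂ) := by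
    simp [walkSum, walkTot, Complex.ofReal_tsum]
  have h2 : ∀ n, hitSum n (fun _ => 1) = (hitTot n : ℂ) := by
    intro n; simp [hitSum, hitTot, Complex.ofReal_tsum]
  simp_rw [h1, h2] at this
  apply Complex.ofReal_injective
  push_cast
  exact this

lemma walkTot_nonneg (n : ℕ) : 0 ≤ walkTot n := tsum_nonneg fun _ => by positivity
lemma hitTot_nonneg (n : ℕ) : 0 ≤ hitTot n := tsum_nonneg fun _ => by positivity

lemma walkTot_le (n : ℕ) : (1/4) ^ n * walkTot n ≤ 1 := by
  have := tot_telescope n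
  have h : 0 ≤ ∑ i ∈ Finset.range n, (1/4 : ℝ) ^ i * hitTot i :=
    Finset.sum_nonneg fun i _ => mul_nonneg (by positivity) (hitTot_nonneg i)
  linarith

lemma summable_hitTot : Summable fun n => (1/4 : ℝ) ^ n * hitTot n := by
  refine summable_of_sum_range_le (c := 1) (fun n => mul_nonneg (by positivity) (hitTot_nonneg n))
    fun N => ?_
  have := tot_telescope N
  have h : 0 ≤ (1/4 : ℝ) ^ N * walkTot N := mul_nonneg (by positivity) (walkTot_nonneg N)
  linarith

lemma norm_hitSum_le (n : ℕ) (f : ℤ × ℤ → ℂ) (M : ℝ) (hM : ∀ k : ℕ, ‖f (-(k : ℤ), 0)‖ ≤ M) :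
    ‖hitSum n f‖ ≤ hitTot n * M := by
  refine tsum_of_norm_bounded ((summable_hitCount n).hasSum.mul_right M) fun k => ?_
  rw [norm_mul, Complex.norm_natCast]
  exact mul_le_mul_of_nonneg_left (hM k) (by positivity)

lemma norm_walkSum_le (n : ℕ) (f : ℤ × ℤ → ℂ) (M : ℝ) (hM : ∀ q, ‖f q‖ ≤ M) :
    ‖walkSum n f‖ ≤ walkTot n * M := by
  refine tsum_of_norm_bounded ((summable_walkNum n).hasSum.mul_right M) fun k => ?_
  rw [norm_mul, Complex.norm_natCast]
  exact mul_le_mul_of_nonneg_left (hM k) (by positivity)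

/-- optional stopping, `0 ≤ t < 1/4` -/
lemma stopping (f : ℤ × ℤ → ℂ) (t : ℝ) (ht0 : 0 ≤ t) (ht : t < 1/4)
    (M : ℝ) (hM : ∀ q, ‖f q‖ ≤ M)
    (hf : ∀ q, q ∉ slitH → f q = t * ∑ e, f (q + stp e)) :
    f (1,0) = ∑' n, (t : ℂ) ^ n * hitSum n f := by
  have hM0 : 0 ≤ M := (norm_nonneg _).trans (hM 0)
  have hs : Summable fun n => (t : ℂ) ^ n * hitSum n f := by
    refine Summable.of_norm_bounded (summable_hitTot.mul_right M) fun n => ?_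
    rw [norm_mul, norm_pow, Complex.norm_real, Real.norm_of_nonneg ht0, mul_assoc]
    exact mul_le_mul (pow_le_pow_left₀ ht0 ht.le n) (norm_hitSum_le n f M fun k => hM _)
      (norm_nonneg _) (by positivity)
  have h1 : Tendsto (fun N => (t : ℂ) ^ N * walkSum N f) atTop (nhds 0) := by
    have h4 : Tendsto (fun N : ℕ => (4 * t) ^ N * M) atTop (nhds 0) := by
      simpa using (tendsto_pow_atTop_nhds_zero_of_lt_one (by linarith : 0 ≤ 4 * t)
        (by linarith)).mul_const M
    refine squeeze_zero_norm (fun N => ?_) h4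
    rw [norm_mul, norm_pow, Complex.norm_real, Real.norm_of_nonneg ht0]
    have h2 := norm_walkSum_le N f M hM
    have h3 := walkTot_le N
    have h5 : walkTot N ≤ 4 ^ N := by
      rw [one_div, inv_pow] at h3
      rwa [inv_mul_le_iff₀ (by positivity), mul_one] at h3
    calc t ^ N * ‖walkSum N f‖ ≤ t ^ N * (4 ^ N * M) := by
          gcongr
          exact h2.trans (by gcongr)
      _ = (4 * t) ^ N * M := by rw [mul_pow]; ring
  have h2 := h1.add hs.hasSum.tendsto_sum_nat
  rw [zero_add] at h2
  refine tendsto_nhds_unique (tendsto_const_nhds.congr fun N => ?_) h2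
  exact walkSum_telescope f t hf N

section analytic

/-- `√((1-αu)(1-βu))`. -/
noncomputable def Rfun (α β : ℝ) (u : ℂ) : ℂ :=
  (1 - α * u) ^ (1/2 : ℂ) * (1 - β * u) ^ (1/2 : ℂ)

lemma re_pos_of {α : ℝ} (h0 : 0 < α) (h1 : α < 1) {u : ℂ} (hu : ‖u‖ ≤ 1) : 0 < (1 - α * u).re := by
  have h := (Complex.re_le_norm u).trans hu
  simp
  nlinarith

lemma mem_slit_of {α : ℝ} (h0 : 0 < α) (h1 : α < 1) {u : ℂ} (hu : ‖u‖ ≤ 1) :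
    (1 - α * u) ∈ Complex.slitPlane := Or.inl (re_pos_of h0 h1 hu)

lemma Rfun_zero (α β : ℝ) : Rfun α β 0 = 1 := by simp [Rfun]

lemma Rfun_ne {α β : ℝ} (ha0 : 0 < α) (ha1 : α < 1) (hb0 : 0 < β) (hb1 : β < 1) {u : ℂ}
    (hu : ‖u‖ ≤ 1) : Rfun α β u ≠ 0 := by
  unfold Rfun
  have h1 := Complex.slitPlane_ne_zero (mem_slit_of ha0 ha1 hu)
  have h2 := Complex.slitPlane_ne_zero (mem_slit_of hb0 hb1 hu)
  simp [Complex.cpow_eq_zero_iff, h1, h2]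

lemma Rfun_diff {α β : ℝ} (ha0 : 0 < α) (ha1 : α < 1) (hb0 : 0 < β) (hb1 : β < 1) {u : ℂ}
    (hu : ‖u‖ ≤ 1) : DifferentiableAt ℂ (Rfun α β) u := by
  unfold Rfun
  have h1 := (mem_slit_of ha0 ha1 hu)
  have h2 := (mem_slit_of hb0 hb1 hu)
  refine DifferentiableAt.mul ?_ ?_
  · exact DifferentiableAt.cpow (by fun_prop) (by fun_prop) h1
  · exact DifferentiableAt.cpow (by fun_prop) (by fun_prop) h2

lemma sqrt_conj_mul {w : ℂ} (hw : w ∈ Complex.slitPlane) :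
    w ^ (1/2 : ℂ) * ((starRingEnd ℂ) w) ^ (1/2 : ℂ) = (‖w‖ : ℂ) := by
  have h : ((starRingEnd ℂ) w) ^ (1/2 : ℂ) = (starRingEnd ℂ) (w ^ (1/2 : ℂ)) := by
    rw [Complex.conj_cpow _ _ (Complex.mem_slitPlane_iff_arg.1 hw).1]
    congr 2
    rw [map_div₀, map_one, Complex.conj_ofNat]
  rw [h, Complex.mul_conj, Complex.normSq_eq_norm_sq]
  congr 1
  rw [← norm_pow, ← Complex.cpow_nat_mul]
  simp

lemma Rfun_conj {α β : ℝ} (ha0 : 0 < α) (ha1 : α < 1) (hb0 : 0 < β) (hb1 : β < 1) {u : ℂ}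
    (hu : ‖u‖ ≤ 1) :
    Rfun α β u * Rfun α β ((starRingEnd ℂ) u) = ((‖1 - α * u‖ * ‖1 - β * u‖ : ℝ) : ℂ) := by
  have h1 := sqrt_conj_mul (mem_slit_of ha0 ha1 hu)
  have h2 := sqrt_conj_mul (mem_slit_of hb0 hb1 hu)
  simp only [map_sub, map_one, map_mul, Complex.conj_ofReal] at h1 h2
  push_cast
  rw [← h1, ← h2]
  unfold Rfun
  ring

/-- parameters -/
structure Par (t α β : ℝ) : Prop where
  t0 : 0 < t
  t1 : t < 1/4
  a0 : 0 < α
  a1 : α < 1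
  b0 : 0 < β
  b1 : β < 1
  ha : t * (1 + α^2) = (1 - 2*t) * α
  hb : t * (1 + β^2) = (1 + 2*t) * β

noncomputable def Aθ (t θ : ℝ) : ℝ := 1 - 2 * t * Real.cos θ
noncomputable def Dθ (t θ : ℝ) : ℝ := Real.sqrt ((Aθ t θ)^2 - 4 * t^2)
noncomputable def Lθ (t θ : ℝ) : ℝ := (Aθ t θ - Dθ t θ) / (2 * t)

variable {t α β : ℝ}

lemma A_gt (P : Par t α β) (θ : ℝ) : 2 * t < Aθ t θ := by
  have := Real.cos_le_one θ
  have := P.t0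
  have := P.t1
  unfold Aθ
  nlinarith

lemma D_sq (P : Par t α β) (θ : ℝ) : Dθ t θ ^ 2 = (Aθ t θ)^2 - 4 * t^2 := by
  have := A_gt P θ
  have := P.t0
  exact Real.sq_sqrt (by nlinarith)

lemma D_nonneg (θ : ℝ) : 0 ≤ Dθ t θ := Real.sqrt_nonneg _

lemma Lth_mul (P : Par t α β) (θ : ℝ) : 2 * t * Lθ t θ = Aθ t θ - Dθ t θ := by
  have := P.t0
  unfold Lθ
  field_simp

lemma L_quad (P : Par t α β) (θ : ℝ) : t * Lθ t θ ^ 2 - Aθ t θ * Lθ t θ + t = 0 := by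
  have h1 := Lth_mul P θ
  have h2 := D_sq P θ
  have ht := P.t0
  have : 4 * t * (t * Lθ t θ ^ 2 - Aθ t θ * Lθ t θ + t) = 0 := by
    have h3 : Dθ t θ = Aθ t θ - 2 * t * Lθ t θ := by linarith
    rw [h3] at h2
    nlinarith
  rcases mul_eq_zero.1 this with h | h
  · linarith
  · exact h

lemma L_abs (P : Par t α β) (θ : ℝ) : |Lθ t θ| ≤ 1 := by
  have h1 := Lth_mul P θ
  have h2 := D_sq P θ
  have h3 := A_gt P θ
  have ht := P.t0
  have hD := D_nonneg (t := t) θ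
  have h4 : Dθ t θ ≤ Aθ t θ := by nlinarith
  have h5 : Aθ t θ - 2 * t ≤ Dθ t θ := by
    apply le_of_sq_le_sq _ hD
    nlinarith
  rw [abs_le]
  constructor <;> nlinarith

lemma D_cont : Continuous (Dθ t) := by
  unfold Dθ Aθ
  fun_prop

lemma L_cont : Continuous (Lθ t) := by
  unfold Lθ Aθ
  have := D_cont (t := t)
  fun_prop

/-- point on the unit circle -/
noncomputable abbrev cu (θ : ℝ) : ℂ := circleMap 0 1 θ

lemma cu_norm (θ : ℝ) : ‖cu θ‖ = 1 := by simp [cu]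
lemma cu_ne (θ : ℝ) : cu θ ≠ 0 := by
  intro h
  have := cu_norm θ
  simp [h] at this

lemma cu_inv (θ : ℝ) : (cu θ)⁻¹ = (starRingEnd ℂ) (cu θ) := by
  rw [Complex.inv_def, Complex.normSq_eq_norm_sq, cu_norm]
  simp

lemma cu_refl (θ : ℝ) : cu (2 * Real.pi - θ) = (cu θ)⁻¹ := by
  simp only [cu, circleMap]
  push_cast
  rw [sub_mul, Complex.exp_sub, Complex.exp_two_pi_mul_I]
  simp

lemma cu_re (θ : ℝ) : (cu θ).re = Real.cos θ := by
  simp [cu, circleMap, Complex.exp_ofReal_mul_I_re]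

lemma cu_add_inv (θ : ℝ) : cu θ + (cu θ)⁻¹ = ((2 * Real.cos θ : ℝ) : ℂ) := by
  rw [cu_inv, Complex.add_conj, cu_re]

lemma norm_sq_one_sub (γ θ : ℝ) : ‖1 - γ * cu θ‖ ^ 2 = 1 + γ^2 - 2 * γ * Real.cos θ := by
  have h := cu_norm θ
  have h2 : (cu θ).re ^ 2 + (cu θ).im ^ 2 = 1 := by
    have := Complex.normSq_eq_norm_sq (cu θ)
    rw [h, Complex.normSq_apply] at this
    nlinarith
  have h3 := cu_re θ
  rw [← Complex.normSq_eq_norm_sq, Complex.normSq_apply]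
  simp only [Complex.sub_re, Complex.one_re, Complex.mul_re, Complex.ofReal_re, Complex.ofReal_im,
    Complex.sub_im, Complex.one_im, Complex.mul_im]
  rw [← h3]
  nlinarith

lemma D_eq (P : Par t α β) (θ : ℝ) :
    Dθ t θ = t / Real.sqrt (α * β) * (‖1 - α * cu θ‖ * ‖1 - β * cu θ‖) := by
  have ha := P.a0
  have hb := P.b0
  have ht := P.t0
  have h1 : 0 ≤ t / Real.sqrt (α * β) * (‖1 - α * cu θ‖ * ‖1 - β * cu θ‖) := by positivity
  rw [← Real.sqrt_sq h1]
  unfold Dθ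
  congr 1
  rw [mul_pow, mul_pow, div_pow, Real.sq_sqrt (by positivity), norm_sq_one_sub, norm_sq_one_sub]
  have e1 : (1 + α^2 - 2 * α * Real.cos θ) * t = α * (Aθ t θ - 2 * t) := by
    have := P.ha
    unfold Aθ
    linear_combination this
  have e2 : (1 + β^2 - 2 * β * Real.cos θ) * t = β * (Aθ t θ + 2 * t) := by
    have := P.hb
    unfold Aθ
    linear_combination this
  have : t^2 / (α * β) * ((1 + α^2 - 2 * α * Real.cos θ) * (1 + β^2 - 2 * β * Real.cos θ)) =
     ((1 + α^2 - 2 * α * Real.cos θ) * t) * ((1 + β^2 - 2 * β * Real.cos θ) * t) / (α * β) := by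
    ring
  rw [this, e1, e2]
  field_simp
  ring

lemma circ_int (f : ℂ → ℂ) : ∫ θ in (0:ℝ)..(2 * Real.pi), cu θ * f (cu θ) =
    Complex.I⁻¹ * ∮ u in C(0,1), f u := by
  simp only [circleIntegral, deriv_circleMap, smul_eq_mul]
  rw [← intervalIntegral.integral_const_mul]
  refine intervalIntegral.integral_congr fun θ _ => ?_
  field_simp

lemma cauchy_at (f : ℂ → ℂ) (hf : ∀ u, ‖u‖ ≤ 1 → DifferentiableAt ℂ f u) (z : ℂ) (hz : ‖z‖ < 1) :
    ∫ θ in (0:ℝ)..(2 * Real.pi), cu θ * ((cu θ - z)⁻¹ * f (cu θ)) = 2 * Real.pi * f z := by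
  rw [circ_int (fun u => (u - z)⁻¹ * f u)]
  have hd : DiffContOnCl ℂ f (Metric.ball 0 1) := by
    apply DifferentiableOn.diffContOnCl_ball (U := Metric.closedBall 0 1)
    · intro u hu
      exact (hf u (by simpa using hu)).differentiableWithinAt
    · exact subset_rfl
  have := hd.circleIntegral_sub_inv_smul (w := z) (by simpa using hz)
  simp only [smul_eq_mul] at this
  rw [this]
  have := Complex.I_ne_zero
  field_simp

lemma cauchy_zero (f : ℂ → ℂ) (hf : ∀ u, ‖u‖ ≤ 1 → DifferentiableAt ℂ f u) :
    ∫ θ in (0:ℝ)..(2 * Real.pi), cu θ * f (cu θ) = 0 := by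
  rw [circ_int f]
  have hd : DiffContOnCl ℂ f (Metric.ball 0 1) := by
    apply DifferentiableOn.diffContOnCl_ball (U := Metric.closedBall 0 1)
    · intro u hu
      exact (hf u (by simpa using hu)).differentiableWithinAt
    · exact subset_rfl
  rw [hd.circleIntegral_eq_zero (by norm_num)]
  simp

/-- the kernel -/
noncomputable def kap (α β : ℝ) (z : ℂ) (θ : ℝ) : ℂ :=
  Rfun α β z * (cu θ * ((cu θ - z)⁻¹ * (Rfun α β (cu θ))⁻¹))

lemma cu_sub_ne {z : ℂ} (hz : ‖z‖ < 1) (θ : ℝ) : cu θ - z ≠ 0 := by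
  intro h
  have := cu_norm θ
  rw [sub_eq_zero.1 h] at this
  linarith

lemma kap_cont (P : Par t α β) {z : ℂ} (hz : ‖z‖ < 1) : Continuous (kap α β z) := by
  have hc : Continuous cu := continuous_circleMap 0 1
  have hR : Continuous fun θ => Rfun α β (cu θ) := by
    rw [continuous_iff_continuousAt]
    intro θ
    exact ContinuousAt.comp (g := Rfun α β)
      (Rfun_diff P.a0 P.a1 P.b0 P.b1 (cu_norm θ).le).continuousAt hc.continuousAt
  unfold kap
  refine continuous_const.mul (hc.mul (Continuous.mul ?_ ?_))
  · exact (hc.sub continuous_const).inv₀ fun θ => cu_sub_ne hz θ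
  · exact hR.inv₀ fun θ => Rfun_ne P.a0 P.a1 P.b0 P.b1 (cu_norm θ).le

noncomputable def integ (t α β : ℝ) (z : ℂ) (q : ℤ × ℤ) (θ : ℝ) : ℂ :=
  kap α β z θ * ((cu θ) ^ (-q.1) * ((Lθ t θ : ℝ) : ℂ) ^ q.2.natAbs)

lemma integ_cont (P : Par t α β) {z : ℂ} (hz : ‖z‖ < 1) (q : ℤ × ℤ) :
    Continuous (integ t α β z q) := by
  have hc : Continuous cu := continuous_circleMap 0 1
  refine (kap_cont P hz).mul (Continuous.mul ?_ ?_)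
  · exact hc.zpow₀ _ fun θ => Or.inl (cu_ne θ)
  · exact (Complex.continuous_ofReal.comp L_cont).pow _

/-- the discrete harmonic function -/
noncomputable def hh (t α β : ℝ) (z : ℂ) (q : ℤ × ℤ) : ℂ :=
  (2 * Real.pi : ℂ)⁻¹ * ∫ θ in (0:ℝ)..(2 * Real.pi), integ t α β z q θ

lemma hh_bdd (P : Par t α β) {z : ℂ} (hz : ‖z‖ < 1) : ∃ M, ∀ q, ‖hh t α β z q‖ ≤ M := by
  obtain ⟨C, hC⟩ := isCompact_Icc.exists_bound_of_continuousOn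
    (s := Set.Icc 0 (2 * Real.pi)) (kap_cont P hz).continuousOn
  refine ⟨‖(2 * Real.pi : ℂ)⁻¹‖ * (C * |2 * Real.pi - 0|), fun q => ?_⟩
  unfold hh
  rw [norm_mul]
  refine mul_le_mul_of_nonneg_left ?_ (norm_nonneg _)
  refine intervalIntegral.norm_integral_le_of_norm_le_const fun θ hθ => ?_
  rw [Set.uIoc_of_le (by positivity)] at hθ
  unfold integ
  rw [norm_mul, norm_mul, norm_zpow, cu_norm, one_zpow, one_mul, norm_pow, Complex.norm_real]
  have h1 : ‖Lθ t θ‖ ^ q.2.natAbs ≤ 1 := pow_le_one₀ (norm_nonneg _) (L_abs P θ)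
  calc _ ≤ ‖kap α β z θ‖ * 1 := by gcongr
    _ ≤ C := by rw [mul_one]; exact hC θ ⟨hθ.1.le, hθ.2⟩

lemma hh_neg (P : Par t α β) {z : ℂ} (hz : ‖z‖ < 1) (k : ℕ) :
    hh t α β z (-(k : ℤ), 0) = z ^ k := by
  unfold hh
  have h := cauchy_at (fun u => u ^ k * (Rfun α β u)⁻¹) (fun u hu => by
    have := Rfun_diff P.a0 P.a1 P.b0 P.b1 hu
    have := Rfun_ne P.a0 P.a1 P.b0 P.b1 hu
    fun_prop (disch := assumption)) z hz
  have h2 : ∫ θ in (0:ℝ)..(2 * Real.pi), integ t α β z (-(k : ℤ), 0) θ =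
      Rfun α β z * ∫ θ in (0:ℝ)..(2 * Real.pi),
        cu θ * ((cu θ - z)⁻¹ * ((cu θ) ^ k * (Rfun α β (cu θ))⁻¹)) := by
    rw [← intervalIntegral.integral_const_mul]
    refine intervalIntegral.integral_congr fun θ _ => ?_
    simp only [integ, kap, neg_neg, zpow_natCast, Int.natAbs_zero, pow_zero]
    ring
  rw [h2, h]
  have := Rfun_ne P.a0 P.a1 P.b0 P.b1 hz.le
  have : (Real.pi : ℂ) ≠ 0 := by exact_mod_cast Real.pi_ne_zero
  field_simp

lemma hh_one (P : Par t α β) {z : ℂ} (hz : ‖z‖ < 1) :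
    z * hh t α β z (1, 0) = 1 - Rfun α β z := by
  unfold hh
  have hd : ∀ u, ‖u‖ ≤ 1 → DifferentiableAt ℂ (fun u => (Rfun α β u)⁻¹) u := fun u hu => by
    have := Rfun_diff P.a0 P.a1 P.b0 P.b1 hu
    have := Rfun_ne P.a0 P.a1 P.b0 P.b1 hu
    fun_prop (disch := assumption)
  have h := cauchy_at _ hd z hz
  have h0 := cauchy_at _ hd 0 (by simp)
  have hc : Continuous cu := continuous_circleMap 0 1
  have hR : Continuous fun θ => Rfun α β (cu θ) := by
    rw [continuous_iff_continuousAt]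
    intro θ
    exact ContinuousAt.comp (g := Rfun α β)
      (Rfun_diff P.a0 P.a1 P.b0 P.b1 (cu_norm θ).le).continuousAt hc.continuousAt
  have hci : ∀ w : ℂ, ‖w‖ < 1 → Continuous fun θ =>
      cu θ * ((cu θ - w)⁻¹ * (Rfun α β (cu θ))⁻¹) := by
    intro w hw
    refine (hc.mul (Continuous.mul ?_ ?_))
    · exact (hc.sub continuous_const).inv₀ fun θ => cu_sub_ne hw θ
    · exact hR.inv₀ fun θ => Rfun_ne P.a0 P.a1 P.b0 P.b1 (cu_norm θ).le
  have h2 : z * ∫ θ in (0:ℝ)..(2 * Real.pi), integ t α β z (1, 0) θ =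
      Rfun α β z * ((∫ θ in (0:ℝ)..(2 * Real.pi),
        cu θ * ((cu θ - z)⁻¹ * (Rfun α β (cu θ))⁻¹)) - ∫ θ in (0:ℝ)..(2 * Real.pi),
        cu θ * ((cu θ - 0)⁻¹ * (Rfun α β (cu θ))⁻¹)) := by
    rw [← intervalIntegral.integral_sub ((hci z hz).intervalIntegrable _ _)
      ((hci 0 (by simp)).intervalIntegrable _ _),
      ← intervalIntegral.integral_const_mul, ← intervalIntegral.integral_const_mul]
    refine intervalIntegral.integral_congr fun θ _ => ?_
    have h1 := cu_sub_ne hz θ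
    have h2 := cu_ne θ
    have h3 := Rfun_ne P.a0 P.a1 P.b0 P.b1 (cu_norm θ).le
    simp only [integ, kap, Int.natAbs_zero, pow_zero, zpow_neg, zpow_one]
    field_simp
    ring
  rw [mul_left_comm, h2, h, h0, Rfun_zero]
  have := Rfun_ne P.a0 P.a1 P.b0 P.b1 hz.le
  have : (Real.pi : ℂ) ≠ 0 := by exact_mod_cast Real.pi_ne_zero
  field_simp

lemma hh_lap (P : Par t α β) {z : ℂ} (hz : ‖z‖ < 1) (q : ℤ × ℤ) :
    hh t α β z q - t * ∑ e, hh t α β z (q + stp e) =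
    (2 * Real.pi : ℂ)⁻¹ * ∫ θ in (0:ℝ)..(2 * Real.pi),
      kap α β z θ * ((cu θ) ^ (-q.1) * (if q.2 = 0 then (Dθ t θ : ℂ) else 0)) := by
  unfold hh
  rw [← Finset.mul_sum, ← intervalIntegral.integral_finsetSum
    (fun e _ => (integ_cont P hz _).intervalIntegrable _ _), mul_left_comm,
    ← mul_sub, ← intervalIntegral.integral_const_mul (t : ℂ), ← intervalIntegral.integral_sub
    ((integ_cont P hz _).intervalIntegrable _ _) (Continuous.intervalIntegrable (by
      have := fun q => integ_cont P hz q
      fun_prop) _ _)]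
  congr 1
  refine intervalIntegral.integral_congr fun θ _ => ?_
  obtain ⟨i, j⟩ := q
  have hu := cu_ne θ
  have hA := cu_add_inv θ
  have hL : (t : ℂ) * (Lθ t θ : ℂ) ^ 2 - (Aθ t θ : ℂ) * (Lθ t θ : ℂ) + t = 0 := by
    exact_mod_cast L_quad P θ
  have hM : (2 : ℂ) * t * (Lθ t θ : ℂ) = (Aθ t θ : ℂ) - (Dθ t θ : ℂ) := by
    exact_mod_cast Lth_mul P θ
  have hA2 : (Aθ t θ : ℂ) = 1 - t * (cu θ + (cu θ)⁻¹) := by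
    rw [hA]; unfold Aθ; push_cast; ring
  simp only [Fin.sum_univ_four, integ, stp]
  simp only [Matrix.cons_val, Prod.mk_add_mk, add_zero]
  have e1 : cu θ ^ (-(i + 1)) = cu θ ^ (-i) * (cu θ)⁻¹ := by
    rw [neg_add, zpow_add₀ hu, zpow_neg_one]
  have e2 : cu θ ^ (-(i + -1)) = cu θ ^ (-i) * cu θ := by
    rw [neg_add, zpow_add₀ hu, neg_neg, zpow_one]
  rw [e1, e2]
  generalize cu θ ^ (-i) = v
  generalize kap α β z θ = κ
  rcases lt_trichotomy j 0 with hj | hj | hj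
  · obtain ⟨m, hm⟩ : ∃ m : ℕ, j = -((m : ℤ) + 1) := ⟨(-j - 1).toNat, by omega⟩
    have n0 : j.natAbs = m + 1 := by omega
    have n1 : (j + 1).natAbs = m := by omega
    have n2 : (j + -1).natAbs = m + 2 := by omega
    rw [n0, n1, n2, if_neg hj.ne]
    rw [hA2] at hL
    linear_combination (-κ * v * (Lθ t θ : ℂ) ^ m) * hL
  · subst hj
    simp only [Int.natAbs_zero, pow_zero, zero_add, Int.natAbs_one, Int.natAbs_neg, pow_one,
      if_true]
    rw [hA2] at hM
    linear_combination (-κ * v) * hM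
  · obtain ⟨m, hm⟩ : ∃ m : ℕ, j = ((m : ℤ) + 1) := ⟨(j - 1).toNat, by omega⟩
    have n0 : j.natAbs = m + 1 := by omega
    have n1 : (j + 1).natAbs = m + 2 := by omega
    have n2 : (j + -1).natAbs = m := by omega
    rw [n0, n1, n2, if_neg hj.ne']
    rw [hA2] at hL
    linear_combination (-κ * v * (Lθ t θ : ℂ) ^ m) * hL

lemma int_zero (P : Par t α β) {z : ℂ} (hz : ‖z‖ < 1) (i : ℕ) :
    ∫ θ in (0:ℝ)..(2 * Real.pi),
      kap α β z θ * ((cu θ) ^ (-((i : ℤ) + 1)) * (Dθ t θ : ℂ)) = 0 := by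
  have h := cauchy_zero (fun u => u ^ i * Rfun α β u * (1 - z * u)⁻¹) (fun u hu => by
    have := Rfun_diff P.a0 P.a1 P.b0 P.b1 hu
    have : 1 - z * u ≠ 0 := by
      intro h
      have h2 : ‖z * u‖ = 1 := by rw [← sub_eq_zero.1 h]; simp
      rw [norm_mul] at h2
      nlinarith [norm_nonneg z, norm_nonneg u]
    fun_prop (disch := assumption))
  have h2 := intervalIntegral.integral_comp_sub_left (a := 0) (b := 2 * Real.pi)
    (fun θ => cu θ * (cu θ ^ i * Rfun α β (cu θ) * (1 - z * cu θ)⁻¹)) (2 * Real.pi)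
  rw [sub_self, sub_zero, h] at h2
  have h3 : ∫ θ in (0:ℝ)..(2 * Real.pi),
      kap α β z θ * ((cu θ) ^ (-((i : ℤ) + 1)) * (Dθ t θ : ℂ)) =
      (Rfun α β z * (t / Real.sqrt (α * β) : ℝ)) * ∫ θ in (0:ℝ)..(2 * Real.pi),
      cu (2 * Real.pi - θ) * (cu (2 * Real.pi - θ) ^ i * Rfun α β (cu (2 * Real.pi - θ))
        * (1 - z * cu (2 * Real.pi - θ))⁻¹) := by
    rw [← intervalIntegral.integral_const_mul]
    refine intervalIntegral.integral_congr fun θ _ => ?_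
    rw [cu_refl]
    have hc := Rfun_conj P.a0 P.a1 P.b0 P.b1 (cu_norm θ).le
    rw [← cu_inv] at hc
    rw [D_eq P θ, Complex.ofReal_mul, ← hc]
    have h1 := cu_sub_ne hz θ
    have h2 := cu_ne θ
    have h3 := Rfun_ne P.a0 P.a1 P.b0 P.b1 (cu_norm θ).le
    have e : cu θ ^ (-((i : ℤ) + 1)) = (cu θ)⁻¹ ^ i * (cu θ)⁻¹ := by
      rw [neg_add, zpow_add₀ h2, zpow_neg_one, zpow_neg, zpow_natCast, inv_pow]
    have e2 : (1 - z * (cu θ)⁻¹)⁻¹ = cu θ * (cu θ - z)⁻¹ := by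
      rw [show (1 - z * (cu θ)⁻¹) = (cu θ)⁻¹ * (cu θ - z) by field_simp, mul_inv, inv_inv]
    rw [e, e2]
    unfold kap
    generalize Rfun α β (cu θ)⁻¹ = r
    field_simp
  rw [h3, h2, mul_zero]

lemma hh_harm (P : Par t α β) {z : ℂ} (hz : ‖z‖ < 1) (q : ℤ × ℤ) (hq : q ∉ slitH) :
    hh t α β z q = t * ∑ e, hh t α β z (q + stp e) := by
  rw [← sub_eq_zero, hh_lap P hz q]
  obtain ⟨i, j⟩ := q
  by_cases hj : j = 0
  · subst hj
    have hi : ¬ i ≤ 0 := fun h => hq ⟨rfl, h⟩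
    obtain ⟨m, hm⟩ : ∃ m : ℕ, i = ((m : ℤ) + 1) := ⟨(i - 1).toNat, by omega⟩
    subst hm
    simp only [if_true]
    rw [int_zero P hz, mul_zero]
  · simp [hj]

lemma gf_lt (P : Par t α β) {z : ℂ} (hz : ‖z‖ < 1) :
    z * ∑' n, (t : ℂ) ^ n * ∑' k : ℕ, (hitCount k n : ℂ) * z ^ k = 1 - Rfun α β z := by
  obtain ⟨M, hM⟩ := hh_bdd P hz
  have h := stopping (hh t α β z) t P.t0.le P.t1 M hM (hh_harm P hz)
  rw [← hh_one P hz, h]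
  simp only [hitSum, hh_neg P hz]

end analytic

section limit

noncomputable def alf (t : ℝ) : ℝ := ((1 - 2*t) - Real.sqrt (1 - 4*t)) / (2*t)
noncomputable def bet (t : ℝ) : ℝ := ((1 + 2*t) - Real.sqrt (1 + 4*t)) / (2*t)

lemma par_ab {t : ℝ} (h0 : 0 < t) (h1 : t < 1/4) : Par t (alf t) (bet t) := by
  have hs := Real.sq_sqrt (show 0 ≤ 1 - 4*t by linarith)
  have hs0 : 0 < Real.sqrt (1 - 4*t) := Real.sqrt_pos.2 (by linarith)
  have hr := Real.sq_sqrt (show 0 ≤ 1 + 4*t by linarith)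
  have hr0 : 0 < Real.sqrt (1 + 4*t) := Real.sqrt_pos.2 (by linarith)
  have ea : 2 * t * alf t = (1 - 2*t) - Real.sqrt (1 - 4*t) := by unfold alf; field_simp
  have eb : 2 * t * bet t = (1 + 2*t) - Real.sqrt (1 + 4*t) := by unfold bet; field_simp
  set s := Real.sqrt (1 - 4*t)
  set r := Real.sqrt (1 + 4*t)
  have hs1 : s < 1 - 2*t := by nlinarith
  have hs2 : 1 - 4*t < s := by nlinarith
  have hr1 : r < 1 + 2*t := by nlinarith
  have hr2 : 1 < r := by nlinarith
  refine ⟨h0, h1, ?_, ?_, ?_, ?_, ?_, ?_⟩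
  · by_contra h; nlinarith
  · by_contra h; nlinarith
  · by_contra h; nlinarith
  · by_contra h; nlinarith
  · have e : s = (1 - 2*t) - 2*t*alf t := by linarith
    rw [e] at hs
    have : 4 * t * (t * (1 + alf t ^ 2) - (1 - 2*t) * alf t) = 0 := by linear_combination hs
    rcases mul_eq_zero.1 this with h | h <;> linarith
  · have e : r = (1 + 2*t) - 2*t*bet t := by linarith
    rw [e] at hr
    have : 4 * t * (t * (1 + bet t ^ 2) - (1 + 2*t) * bet t) = 0 := by linear_combination hr
    rcases mul_eq_zero.1 this with h | h <;> linarith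

lemma csqrt_ofReal {x : ℝ} (hx : 0 ≤ x) : (x : ℂ) ^ (1/2 : ℂ) = (Real.sqrt x : ℂ) := by
  rw [Real.sqrt_eq_rpow, Complex.ofReal_cpow hx]
  norm_num

noncomputable def hitPoly (z : ℝ) (n : ℕ) : ℝ := ∑' k : ℕ, (hitCount k n : ℝ) * z ^ k

lemma one_sub_mul_pos {γ z : ℝ} (h0 : 0 < γ) (h1 : γ < 1) (hz : |z| < 1) : 0 < 1 - γ * z := by
  have := abs_lt.1 hz
  nlinarith

lemma gf_lt_real {t z : ℝ} (h0 : 0 < t) (h1 : t < 1/4) (hz : |z| < 1) :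
    z * ∑' n, t ^ n * hitPoly z n =
      1 - Real.sqrt (1 - alf t * z) * Real.sqrt (1 - bet t * z) := by
  have P := par_ab h0 h1
  have h := gf_lt P (z := (z : ℂ)) (by simpa using hz)
  apply Complex.ofReal_injective
  unfold hitPoly
  have hR : Rfun (alf t) (bet t) (z : ℂ) =
      ((Real.sqrt (1 - alf t * z) * Real.sqrt (1 - bet t * z) : ℝ) : ℂ) := by
    unfold Rfun
    push_cast
    rw [← csqrt_ofReal (one_sub_mul_pos P.a0 P.a1 hz).le, ← csqrt_ofReal (one_sub_mul_pos P.b0 P.b1 hz).le]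
    push_cast
    rfl
  rw [hR] at h
  push_cast [Complex.ofReal_tsum] at h ⊢
  exact h

lemma hitPoly_abs {z : ℝ} (hz : |z| < 1) (n : ℕ) : ‖hitPoly z n‖ ≤ hitTot n := by
  refine tsum_of_norm_bounded (summable_hitCount n).hasSum fun k => ?_
  rw [norm_mul, norm_pow, Real.norm_natCast]
  exact mul_le_of_le_one_right (by positivity) (pow_le_one₀ (norm_nonneg _) hz.le)

lemma gf_quarter {z : ℝ} (hz : |z| < 1) :
    z * ∑' n, (1/4 : ℝ) ^ n * hitPoly z n =
      1 - Real.sqrt ((1 - z) * (1 - z * (3 - 2 * Real.sqrt 2))) := by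
  have hl : Tendsto (fun t : ℝ => z * ∑' n, t ^ n * hitPoly z n) (nhdsWithin (1/4) (Set.Iio (1/4)))
      (nhds (z * ∑' n, (1/4 : ℝ) ^ n * hitPoly z n)) := by
    refine Tendsto.const_mul z ?_
    refine tendsto_tsum_of_dominated_convergence summable_hitTot (fun n => ?_) ?_
    · refine Tendsto.mul_const _ ?_
      exact ((continuous_pow n).tendsto _).mono_left nhdsWithin_le_nhds
    · have : Set.Ioo (0:ℝ) (1/4) ∈ nhdsWithin (1/4 : ℝ) (Set.Iio (1/4)) :=
        Ioo_mem_nhdsLT (by norm_num)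
      filter_upwards [this] with t ht n
      rw [norm_mul, norm_pow, Real.norm_of_nonneg ht.1.le]
      exact mul_le_mul (pow_le_pow_left₀ ht.1.le ht.2.le n) (hitPoly_abs hz n) (norm_nonneg _)
        (by positivity)
  have hr : Tendsto (fun t : ℝ => 1 - Real.sqrt (1 - alf t * z) * Real.sqrt (1 - bet t * z))
      (nhdsWithin (1/4) (Set.Iio (1/4)))
      (nhds (1 - Real.sqrt (1 - alf (1/4) * z) * Real.sqrt (1 - bet (1/4) * z))) := by
    refine Tendsto.mono_left ?_ nhdsWithin_le_nhds
    have ha : ContinuousAt alf (1/4) := by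
      unfold alf
      exact ContinuousAt.div (by fun_prop) (by fun_prop) (by norm_num)
    have hb : ContinuousAt bet (1/4) := by
      unfold bet
      exact ContinuousAt.div (by fun_prop) (by fun_prop) (by norm_num)
    have : ContinuousAt (fun t : ℝ => 1 - Real.sqrt (1 - alf t * z) * Real.sqrt (1 - bet t * z))
      (1/4) := by fun_prop
    exact this
  have he : (fun t : ℝ => z * ∑' n, t ^ n * hitPoly z n) =ᶠ[nhdsWithin (1/4) (Set.Iio (1/4))]
      (fun t : ℝ => 1 - Real.sqrt (1 - alf t * z) * Real.sqrt (1 - bet t * z)) := by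
    have : Set.Ioo (0:ℝ) (1/4) ∈ nhdsWithin (1/4 : ℝ) (Set.Iio (1/4)) :=
      Ioo_mem_nhdsLT (by norm_num)
    filter_upwards [this] with t ht
    exact gf_lt_real ht.1 ht.2 hz
  have h := tendsto_nhds_unique (hl.congr' he) hr
  rw [h]
  have e1 : alf (1/4) = 1 := by unfold alf; norm_num
  have e2 : bet (1/4) = 3 - 2 * Real.sqrt 2 := by unfold bet; norm_num; ring
  have hz1 := abs_lt.1 hz
  rw [e1, e2, Real.sqrt_mul (by linarith), one_mul, mul_comm z]

lemma summable_F : Summable (Function.uncurry fun (n k : ℕ) => (1/4 : ℝ) ^ n * hitCount k n) := by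
  rw [summable_prod_of_nonneg (fun x => by simp only [Function.uncurry]; positivity)]
  constructor
  · intro n
    exact (summable_hitCount n).mul_left ((1/4 : ℝ) ^ n)
  · refine summable_hitTot.congr fun n => ?_
    simp only [Function.uncurry]
    rw [tsum_mul_left]
    rfl

lemma hitProb_eq (k : ℕ) : hitProb k = ∑' n, (1/4 : ℝ) ^ n * hitCount k n := by
  unfold hitProb
  refine tsum_congr fun n => ?_
  rw [one_div, inv_pow]
  ring

lemma summable_hitProb : Summable hitProb := by
  have := summable_F.prod_symm.prod
  refine this.congr fun k => ?_
  rw [hitProb_eq]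
  rfl

lemma hitProb_nonneg (k : ℕ) : 0 ≤ hitProb k := tsum_nonneg fun _ => by positivity

lemma summable_hitProb_pow {z : ℝ} (hz : |z| < 1) : Summable fun k => hitProb k * z ^ k := by
  refine Summable.of_norm_bounded summable_hitProb fun k => ?_
  rw [norm_mul, norm_pow, Real.norm_of_nonneg (hitProb_nonneg k)]
  exact mul_le_of_le_one_right (hitProb_nonneg k) (pow_le_one₀ (norm_nonneg _) hz.le)

lemma gf_main {z : ℝ} (hz : |z| < 1) :
    z * ∑' k, hitProb k * z ^ k =
      1 - Real.sqrt ((1 - z) * (1 - z * (3 - 2 * Real.sqrt 2))) := by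
  rw [← gf_quarter hz]
  congr 1
  have hs : Summable (Function.uncurry fun (n k : ℕ) => (1/4 : ℝ) ^ n * hitCount k n * z ^ k) := by
    refine Summable.of_norm_bounded summable_F fun x => ?_
    simp only [Function.uncurry]
    rw [norm_mul, norm_pow, Real.norm_of_nonneg (by positivity)]
    exact mul_le_of_le_one_right (by positivity) (pow_le_one₀ (norm_nonneg _) hz.le)
  calc ∑' k, hitProb k * z ^ k = ∑' k, ∑' n, (1/4 : ℝ) ^ n * hitCount k n * z ^ k := by
        refine tsum_congr fun k => ?_
        rw [hitProb_eq, tsum_mul_right]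
    _ = ∑' n, ∑' k, (1/4 : ℝ) ^ n * hitCount k n * z ^ k := hs.tsum_comm
    _ = _ := by
        refine tsum_congr fun n => ?_
        unfold hitPoly
        rw [← tsum_mul_left]
        refine tsum_congr fun k => ?_
        ring

end limit

section asymp

/-- Taylor coefficients of `√(1-z)` -/
noncomputable def ec (n : ℕ) : ℝ := (-1) ^ n * Ring.choose (1/2 : ℝ) n

lemma ec_zero : ec 0 = 1 := by simp [ec]

lemma ec_succ (n : ℕ) : ec (n+1) = ec n * ((n - 1/2) / (n+1)) := by
  unfold ec
  rw [Ring.choose_eq_smul, Ring.choose_eq_smul, descPochhammer_succ_right, Polynomial.smeval_mul,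
    Polynomial.smeval_sub, Polynomial.smeval_X, Polynomial.smeval_natCast, Nat.factorial_succ]
  have : (n.factorial : ℝ) ≠ 0 := by positivity
  simp only [smul_eq_mul, nsmul_eq_mul]
  push_cast
  field_simp
  ring

lemma ec_hasSum {z : ℝ} (hz : |z| < 1) : HasSum (fun n => ec n * z ^ n) (Real.sqrt (1 - z)) := by
  have h := (Real.one_add_rpow_hasFPowerSeriesOnBall_zero (a := 1/2)).hasSum (y := -z) (by
    rw [Metric.mem_eball, edist_zero_right]
    rw [← ofReal_norm]
    simpa using hz)
  rw [Real.sqrt_eq_rpow]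
  have e : (fun n => (binomialSeries ℝ (1/2 : ℝ) n) fun _ => -z) = fun n => ec n * z ^ n := by
    funext n
    rw [binomialSeries_apply]
    simp only [List.ofFn_const, List.prod_replicate, smul_eq_mul, ec]
    rw [neg_pow z]
    ring
  rw [e, show 1 + (0 + -z) = 1 - z by ring] at h
  exact h

/-- `c n = binom(2n,n)/4^n` -/
noncomputable def cc (n : ℕ) : ℝ := (n.centralBinom : ℝ) / 4 ^ n

lemma cc_pos (n : ℕ) : 0 < cc n := by
  have := Nat.centralBinom_pos n
  unfold cc
  positivity

lemma cc_succ (n : ℕ) : cc (n+1) = cc n * ((2*n+1) / (2*n+2)) := by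
  have h : ((n : ℝ)+1) * ((n+1).centralBinom : ℝ) = 2 * (2*n+1) * (n.centralBinom : ℝ) := by
    exact_mod_cast Nat.succ_mul_centralBinom_succ n
  unfold cc
  rw [pow_succ]
  field_simp
  linear_combination 2 * h

lemma ec_cc (n : ℕ) : ec (n+1) = -(cc n / (2 * (n+1))) := by
  induction n with
  | zero => rw [ec_succ, ec_zero]; simp [cc]
  | succ n ih =>
    rw [ec_succ, ih, cc_succ]
    push_cast
    field_simp
    ring

lemma cc_sub (n : ℕ) : cc n - cc (n+1) = -ec (n+1) := by
  rw [ec_cc, cc_succ]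
  field_simp
  ring

lemma cc_wallis (n : ℕ) : cc n ^ 2 * (2*n+1) * Real.Wallis.W n = 1 := by
  induction n with
  | zero => simp [cc, Real.Wallis.W]
  | succ n ih =>
    refine Eq.trans ?_ ih
    rw [cc_succ, Real.Wallis.W_succ]
    push_cast
    field_simp
    ring

lemma cc_tendsto : Tendsto (fun n : ℕ => cc n * Real.sqrt n) atTop (nhds (Real.sqrt (1/Real.pi))) := by
  have h1 : Tendsto (fun n : ℕ => ((n : ℝ) / (2*n+1))) atTop (nhds (1/2)) := by
    have h := tendsto_natCast_div_add_atTop (1/2 : ℝ)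
    have h2 := h.const_mul (1/2 : ℝ)
    rw [mul_one] at h2
    refine h2.congr fun n => ?_
    field_simp
  have h2 := h1.div Real.Wallis.tendsto_W_nhds_pi_div_two (by positivity)
  have h3 := (Real.continuous_sqrt.tendsto _).comp h2
  have e : (1/2 : ℝ) / (Real.pi / 2) = 1 / Real.pi := by
    have := Real.pi_ne_zero
    field_simp
  rw [e] at h3
  refine h3.congr fun n => ?_
  have hc := cc_pos n
  have hw := Real.Wallis.W_pos n
  have hcw := cc_wallis n
  simp only [Function.comp, Pi.div_apply]
  rw [← Real.sqrt_sq (show 0 ≤ cc n * Real.sqrt n by positivity), mul_pow,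
    Real.sq_sqrt (by positivity)]
  congr 1
  field_simp
  linear_combination (-(n : ℝ)) * hcw

lemma cc_tendsto_zero : Tendsto cc atTop (nhds 0) := by
  have h1 : Tendsto (fun n : ℕ => (Real.sqrt (n : ℝ))⁻¹) atTop (nhds 0) :=
    (tendsto_inv_atTop_zero.comp Real.tendsto_sqrt_atTop).comp tendsto_natCast_atTop_atTop
  have h2 := cc_tendsto.mul h1
  rw [mul_zero] at h2
  refine h2.congr' ?_
  filter_upwards [eventually_gt_atTop 0] with n hn
  have : 0 < Real.sqrt (n : ℝ) := Real.sqrt_pos.2 (by exact_mod_cast hn)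
  field_simp

lemma cc_tail (k : ℕ) : HasSum (fun l => cc (k+l) - cc (k+l+1)) (cc k) := by
  have hnn : ∀ l, 0 ≤ cc (k+l) - cc (k+l+1) := fun l => by
    rw [cc_sub, ec_cc, neg_neg]
    have := cc_pos (k+l)
    positivity
  rw [hasSum_iff_tendsto_nat_of_nonneg hnn]
  have h : ∀ n, ∑ l ∈ Finset.range n, (cc (k+l) - cc (k+l+1)) = cc k - cc (k+n) := fun n => by
    have := Finset.sum_range_sub' (fun l => cc (k+l)) n
    simpa [add_assoc] using this
  simp_rw [h]
  have h2 : Tendsto (fun n => cc (k+n)) atTop (nhds 0) :=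
    cc_tendsto_zero.comp (tendsto_add_atTop_nat k |>.congr fun n => by ring)
  simpa using h2.const_sub (cc k)

lemma ec_ne (n : ℕ) : ec n ≠ 0 := by
  cases n with
  | zero => simp [ec_zero]
  | succ n =>
    rw [ec_cc]
    have := cc_pos n
    have : 0 < cc n / (2 * (n+1)) := by positivity
    linarith

lemma ec_ratio (n : ℕ) : |ec n| ≤ 4 * |ec (n+1)| := by
  rw [ec_succ, abs_mul]
  have h : 1/4 ≤ |((n:ℝ) - 1/2) / (n+1)| := by
    rcases Nat.eq_zero_or_pos n with h | h
    · subst h; norm_num [abs_of_neg]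
    · have h1 : (1:ℝ) ≤ n := by exact_mod_cast h
      rw [abs_of_nonneg (div_nonneg (by linarith) (by linarith)), le_div_iff₀ (by linarith)]
      linarith
  nlinarith [abs_nonneg (ec n)]

lemma ec_ratio_pow (n m : ℕ) : |ec n| ≤ 4 ^ m * |ec (n+m)| := by
  induction m with
  | zero => simp
  | succ m ih =>
    have := ec_ratio (n+m)
    calc |ec n| ≤ 4 ^ m * |ec (n+m)| := ih
      _ ≤ 4 ^ m * (4 * |ec (n+m+1)|) := by gcongr
      _ = 4 ^ (m+1) * |ec (n+(m+1))| := by rw [pow_succ, add_assoc]; ring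

lemma ec_abs_le (n : ℕ) : |ec n| ≤ 1 := by
  induction n with
  | zero => simp [ec_zero]
  | succ n ih =>
    rw [ec_succ, abs_mul]
    have h : |((n:ℝ) - 1/2) / (n+1)| ≤ 1 := by
      have : (0:ℝ) ≤ n := by positivity
      rw [abs_le]
      constructor
      · rw [le_div_iff₀ (by linarith)]; linarith
      · rw [div_le_iff₀ (by linarith)]; linarith
    exact mul_le_one₀ ih (abs_nonneg _) h

lemma ec_ratio_tendsto (m : ℕ) : Tendsto (fun n => ec n / ec (n+m)) atTop (nhds 1) := by
  induction m with
  | zero => simp [ec_ne]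
  | succ m ih =>
    have h1 : Tendsto (fun n : ℕ => ec n / ec (n+1)) atTop (nhds 1) := by
      have h := tendsto_natCast_div_add_atTop (1 : ℝ)
      have hm := tendsto_natCast_div_add_atTop (-1/2 : ℝ)
      have h2 := hm.div h one_ne_zero
      rw [div_one] at h2
      refine h2.congr' ?_
      filter_upwards [eventually_gt_atTop 0] with n hn
      have hn1 : (1:ℝ) ≤ n := by exact_mod_cast hn
      have h3 := ec_ne n
      have h4 : (n:ℝ) - 1/2 ≠ 0 := by linarith
      have h5 : (n:ℝ) ≠ 0 := by linarith
      rw [ec_succ, div_mul_cancel_left₀ h3, inv_div]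
      simp only [Pi.div_apply]
      rw [show (n:ℝ) + -1/2 = n - 1/2 by ring]
      field_simp
    have h2 := ih.mul (h1.comp (tendsto_add_atTop_nat m))
    rw [one_mul] at h2
    refine h2.congr fun n => ?_
    have := ec_ne (n+m)
    simp only [Function.comp]
    rw [← add_assoc]
    field_simp

/-- coefficients of the product -/
noncomputable def qc (a : ℝ) (n : ℕ) : ℝ := ∑ j ∈ Finset.range (n+1), ec j * a ^ j * ec (n - j)

lemma qc_hasSum {a z : ℝ} (ha0 : 0 ≤ a) (ha1 : a < 1) (hz : |z| < 1) :
    HasSum (fun n => qc a n * z ^ n) (Real.sqrt (1 - a * z) * Real.sqrt (1 - z)) := by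
  have haz : |a * z| < 1 := by
    rw [abs_mul, abs_of_nonneg ha0]
    nlinarith [abs_nonneg z]
  have h1 := ec_hasSum haz
  have h2 := ec_hasSum hz
  have h := hasSum_sum_range_mul_of_summable_norm h1.summable.norm h2.summable.norm
  rw [h1.tsum_eq, h2.tsum_eq] at h
  suffices e0 : (fun n => qc a n * z ^ n) = fun n => ∑ k ∈ Finset.range (n + 1),
      ec k * (a * z) ^ k * (ec (n - k) * z ^ (n - k)) by
    rw [e0]; exact h
  funext n
  unfold qc
  rw [Finset.sum_mul]
  refine Finset.sum_congr rfl fun j hj => ?_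
  have : j ≤ n := by simp at hj; omega
  have e : z ^ n = z ^ j * z ^ (n - j) := by rw [← pow_add]; congr 1; omega
  rw [e, mul_pow]
  ring

lemma qc_tendsto {a : ℝ} (ha0 : 0 ≤ a) (ha : 4 * a < 1) :
    Tendsto (fun n => qc a n / ec n) atTop (nhds (Real.sqrt (1 - a))) := by
  have hs := (ec_hasSum (z := a) (by rw [abs_of_nonneg ha0]; linarith)).tsum_eq
  rw [← hs]
  have e : ∀ n, qc a n / ec n =
      ∑' j, if j ∈ Finset.range (n+1) then ec j * a ^ j * ec (n - j) / ec n else 0 := by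
    intro n
    unfold qc
    rw [Finset.sum_div, tsum_eq_sum (s := Finset.range (n+1))]
    · exact Finset.sum_congr rfl fun j hj => by rw [if_pos hj]
    · intro j hj
      rw [if_neg hj]
  simp_rw [e]
  refine tendsto_tsum_of_dominated_convergence (bound := fun j => (4 * a) ^ j)
    (summable_geometric_of_lt_one (by linarith) ha) (fun j => ?_) (Eventually.of_forall fun n j => ?_)
  · rw [← tendsto_add_atTop_iff_nat j]
    have h := (ec_ratio_tendsto j).const_mul (ec j * a ^ j)
    rw [mul_one] at h
    refine h.congr fun n => ?_
    rw [if_pos (by simp), Nat.add_sub_cancel]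
    ring
  · split_ifs with hj
    · have hj1 : j ≤ n := by simp at hj; omega
      obtain ⟨m, rfl⟩ := Nat.exists_eq_add_of_le' hj1
      rw [Nat.add_sub_cancel]
      have h1 := ec_ratio_pow m j
      have h2 := ec_abs_le j
      have h3 : 0 < |ec (m+j)| := abs_pos.2 (ec_ne _)
      rw [Real.norm_eq_abs, abs_div, abs_mul, abs_mul, abs_pow, abs_of_nonneg ha0,
        div_le_iff₀ h3, mul_pow]
      calc |ec j| * a ^ j * |ec m| ≤ 1 * a ^ j * (4 ^ j * |ec (m+j)|) := by gcongr
        _ = _ := by ring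
    · simp only [norm_zero]; positivity

/-- `(√2-1)²` -/
noncomputable def aa : ℝ := 3 - 2 * Real.sqrt 2

lemma aa_nonneg : 0 ≤ aa := by
  have h := Real.sq_sqrt (show (0:ℝ) ≤ 2 by norm_num)
  unfold aa
  nlinarith [Real.sqrt_nonneg 2]

lemma aa_lt : 4 * aa < 1 := by
  have h : (11/8 : ℝ) < Real.sqrt 2 := by
    rw [Real.lt_sqrt (by norm_num)]; norm_num
  unfold aa
  linarith

lemma hitProb_qc (k : ℕ) : hitProb k = - qc aa (k+1) := by
  let g : ℕ → ℝ := fun n => Nat.casesOn n 0 (fun k => hitProb k + qc aa (k+1))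
  have hq0 : qc aa 0 = 1 := by simp [qc, ec_zero]
  have hg : HasFPowerSeriesAt (0 : ℝ → ℝ) (FormalMultilinearSeries.ofScalars ℝ g) 0 := by
    rw [hasFPowerSeriesAt_iff]
    have : Metric.ball (0:ℝ) 1 ∈ nhds (0:ℝ) := Metric.ball_mem_nhds _ one_pos
    filter_upwards [this] with z hz
    have hz1 : |z| < 1 := by simpa using hz
    have h1 := qc_hasSum aa_nonneg (by linarith [aa_lt, aa_nonneg]) hz1
    rw [← hasSum_nat_add_iff' 1] at h1
    have h2 := (summable_hitProb_pow hz1).hasSum.mul_left z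
    rw [gf_main hz1] at h2
    rw [← hasSum_nat_add_iff' 1]
    convert h1.add h2 using 1
    · funext n
      simp only [FormalMultilinearSeries.coeff_ofScalars, smul_eq_mul, g]
      ring
    · have hzz := abs_lt.1 hz1
      rw [Real.sqrt_mul (by linarith)]
      have hg0 : g 0 = 0 := rfl
      simp only [FormalMultilinearSeries.coeff_ofScalars, hg0, hq0, Finset.sum_range_one, pow_zero,
        smul_eq_mul, Pi.zero_apply]
      rw [show z * (3 - 2 * Real.sqrt 2) = aa * z by unfold aa; ring]
      ring
  have h0 := hg.eq_zero
  have h1 : (FormalMultilinearSeries.ofScalars ℝ g).coeff (k+1) = 0 := by rw [h0]; rfl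
  rw [FormalMultilinearSeries.coeff_ofScalars] at h1
  have h2 : hitProb k + qc aa (k+1) = 0 := h1
  linarith

lemma hitProb_ratio :
    Tendsto (fun k => hitProb k / (cc k - cc (k+1))) atTop (nhds (Real.sqrt (1 - aa))) := by
  have h := (qc_tendsto aa_nonneg aa_lt).comp (tendsto_add_atTop_nat 1)
  refine h.congr fun k => ?_
  rw [cc_sub, hitProb_qc]
  simp

lemma diff_pos (k : ℕ) : 0 < cc k - cc (k+1) := by
  rw [cc_sub, ec_cc, neg_neg]
  have := cc_pos k
  positivity

lemma tail_ratio :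
    Tendsto (fun k => (∑' l, hitProb (k+l)) / cc k) atTop (nhds (Real.sqrt (1 - aa))) := by
  rw [Metric.tendsto_atTop]
  intro ε hε
  obtain ⟨K, hK⟩ := Metric.tendsto_atTop.1 hitProb_ratio (ε/2) (by linarith)
  refine ⟨K, fun k hk => ?_⟩
  have hs : Summable fun l => hitProb (k+l) :=
    summable_hitProb.comp_injective (add_right_injective k)
  have h1 := hs.hasSum.sub ((cc_tail k).mul_left (Real.sqrt (1 - aa)))
  have h2 : ‖(∑' l, hitProb (k+l)) - Real.sqrt (1 - aa) * cc k‖ ≤ ε/2 * cc k := by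
    rw [← h1.tsum_eq]
    refine tsum_of_norm_bounded ((cc_tail k).mul_left (ε/2)) fun l => ?_
    have h3 := hK (k+l) (by omega)
    have hd := diff_pos (k+l)
    rw [Real.dist_eq] at h3
    have e : hitProb (k+l) - Real.sqrt (1 - aa) * (cc (k+l) - cc (k+l+1)) =
       (hitProb (k+l) / (cc (k+l) - cc (k+l+1)) - Real.sqrt (1 - aa)) * (cc (k+l) - cc (k+l+1)) := by
      field_simp
    rw [e, norm_mul, Real.norm_eq_abs, Real.norm_of_nonneg hd.le]
    exact mul_le_mul_of_nonneg_right h3.le hd.le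
  have hc := cc_pos k
  rw [Real.dist_eq]
  have e : (∑' l, hitProb (k+l)) / cc k - Real.sqrt (1 - aa) =
      ((∑' l, hitProb (k+l)) - Real.sqrt (1 - aa) * cc k) / cc k := by field_simp
  rw [e, abs_div, abs_of_pos hc, div_lt_iff₀ hc]
  rw [Real.norm_eq_abs] at h2
  nlinarith

end asymp
/-- the hitting distribution of the half-line `H` starting from `(1,0)`:
its generating function is `(1 − √((1−z)(1−z(3−2√2))))/z` for `|z| < 1` (stated here
multiplied through by `z`), with the asymptotics `p^{[k]} ∼ √((√2−1)/(2π))·k^{−3/2}`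
and `∑_{ℓ≥k} p^{[ℓ]} ∼ √(2(√2−1)/π)·k^{−1/2}` as `k → ∞`. -/
theorem hitting_distribution_half_line :
    (∀ z : ℝ, |z| < 1 →
      z * ∑' k : ℕ, hitProb k * z ^ k
        = 1 - Real.sqrt ((1 - z) * (1 - z * (3 - 2 * Real.sqrt 2))))
    ∧ Tendsto (fun k : ℕ =>
        hitProb k /
          (Real.sqrt ((Real.sqrt 2 - 1) / (2 * Real.pi)) * (k : ℝ) ^ (-(3/2 : ℝ))))
        atTop (nhds 1)
    ∧ Tendsto (fun k : ℕ =>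
        (∑' l : ℕ, hitProb (k + l)) /
          (Real.sqrt (2 * (Real.sqrt 2 - 1) / Real.pi) * (k : ℝ) ^ (-(1/2 : ℝ))))
        atTop (nhds 1) := by
  have h2 : (1:ℝ) < Real.sqrt 2 := by rw [Real.lt_sqrt (by norm_num)]; norm_num
  have hpi := Real.pi_pos
  have ea : 1 - aa = 2 * (Real.sqrt 2 - 1) := by unfold aa; ring
  refine ⟨fun z hz => gf_main hz, ?_, ?_⟩
  · set C := Real.sqrt ((Real.sqrt 2 - 1) / (2 * Real.pi)) with hC
    have hC0 : 0 < C := Real.sqrt_pos.2 (div_pos (by linarith) (by linarith))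
    have h1 : Tendsto (fun n : ℕ => ((n : ℝ) / (2*n+2))) atTop (nhds (1/2)) := by
      have h := (tendsto_natCast_div_add_atTop (1 : ℝ)).const_mul (1/2 : ℝ)
      rw [mul_one] at h
      refine h.congr fun n => ?_
      field_simp
    have h := ((hitProb_ratio.mul cc_tendsto).mul h1).div_const C
    have e : Real.sqrt (1 - aa) * Real.sqrt (1 / Real.pi) * (1/2) / C = 1 := by
      rw [div_eq_one_iff_eq hC0.ne', hC, ea, ← Real.sqrt_mul (by linarith)]
      rw [show (1/2 : ℝ) = Real.sqrt (1/4) by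
        rw [show (1/4 : ℝ) = (1/2)^2 by norm_num, Real.sqrt_sq (by norm_num)]]
      rw [← Real.sqrt_mul (mul_nonneg (by linarith) (by positivity))]
      congr 1
      field_simp
      ring
    rw [e] at h
    refine h.congr' ?_
    filter_upwards [eventually_gt_atTop 0] with k hk
    have hk1 : (0:ℝ) < k := by exact_mod_cast hk
    have hp : (k:ℝ) ^ (-(3/2 : ℝ)) = (k * Real.sqrt k)⁻¹ := by
      rw [Real.rpow_neg hk1.le, show (3/2 : ℝ) = 1 + 1/2 by norm_num, Real.rpow_add hk1,
        Real.rpow_one, ← Real.sqrt_eq_rpow]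
    have hsq : 0 < Real.sqrt k := Real.sqrt_pos.2 hk1
    have hc := cc_pos k
    rw [hp, cc_sub, ec_cc]
    field_simp
  · set C := Real.sqrt (2 * (Real.sqrt 2 - 1) / Real.pi) with hC
    have hC0 : 0 < C := Real.sqrt_pos.2 (div_pos (by linarith) (by linarith))
    have h := (tail_ratio.mul cc_tendsto).div_const C
    have e : Real.sqrt (1 - aa) * Real.sqrt (1 / Real.pi) / C = 1 := by
      rw [div_eq_one_iff_eq hC0.ne', hC, ea, ← Real.sqrt_mul (by linarith)]
      congr 1
      field_simp
    rw [e] at h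
    refine h.congr' ?_
    filter_upwards [eventually_gt_atTop 0] with k hk
    have hk1 : (0:ℝ) < k := by exact_mod_cast hk
    have hp : (k:ℝ) ^ (-(1/2 : ℝ)) = (Real.sqrt k)⁻¹ := by
      rw [Real.rpow_neg hk1.le, ← Real.sqrt_eq_rpow]
    have hsq : 0 < Real.sqrt k := Real.sqrt_pos.2 hk1
    have hc := cc_pos k
    rw [hp]
    field_simp
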